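/- For every P̃ in the topological boundary ∂F of F, there is exactly one x ∈ ℝⁿ (without any sign restriction) satisfying P_c(x) = P̃; this x has all entries positive and lies in ∂D. Moreover, the restriction of P_c to ∂D is a bijection from ∂D onto ∂F. -/

import Mathlib

open Matrix Set

noncomputable section

/-- `A` is irreducible: for every nonempty proper subset `α` of the index set,
the submatrix `A[α, αᶜ]` is not the zero matrix. -/
def IsIrred {k : ℕ} (A : Matrix (Fin k) (Fin k) ℝ) : Prop :=
  ∀ α : Finset (Fin k), α.Nonempty → α ≠ Finset.univ → ∃ i ∈ α, ∃ j ∈ αᶜ, A i j ≠ 0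

/-- `A` is a Z-matrix: off-diagonal entries are nonpositive. -/
def IsZmat {k : ℕ} (A : Matrix (Fin k) (Fin k) ℝ) : Prop :=
  ∀ i j, i ≠ j → A i j ≤ 0

/-- `A` is an M-matrix: a Z-matrix all of whose eigenvalues have nonnegative real part. -/
def IsMmat {k : ℕ} (A : Matrix (Fin k) (Fin k) ℝ) : Prop :=
  IsZmat A ∧ ∀ μ ∈ spectrum ℂ (A.map (Complex.ofReal)), 0 ≤ μ.re

/-- `A` is a nonsingular M-matrix: a Z-matrix all of whose eigenvalues have positive real part. -/
def IsNonsingMmat {k : ℕ} (A : Matrix (Fin k) (Fin k) ℝ) : Prop :=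
  IsZmat A ∧ ∀ μ ∈ spectrum ℂ (A.map (Complex.ofReal)), 0 < μ.re

/-- `P_c(x) = [x] Y (V* − x)`. -/
def Pc {k : ℕ} (Y : Matrix (Fin k) (Fin k) ℝ) (Vs : Fin k → ℝ) (x : Fin k → ℝ) : Fin k → ℝ :=
  Matrix.diagonal x *ᵥ (Y *ᵥ (Vs - x))

/-- Jacobian of `P_c` at `x`: `J(x) = [Y(V* − x)] − [x] Y`. -/
def Jmat {k : ℕ} (Y : Matrix (Fin k) (Fin k) ℝ) (Vs : Fin k → ℝ) (x : Fin k → ℝ) :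
    Matrix (Fin k) (Fin k) ℝ :=
  Matrix.diagonal (Y *ᵥ (Vs - x)) - Matrix.diagonal x * Y

/-- long-term voltage stable operating points. -/
def Dset {k : ℕ} (Y : Matrix (Fin k) (Fin k) ℝ) (Vs : Fin k → ℝ) : Set (Fin k → ℝ) :=
  {x | (∀ i, 0 < x i) ∧ IsUnit (Jmat Y Vs x).det ∧ ∀ i j, (Jmat Y Vs x)⁻¹ i j < 0}

/-- feasible power demands. -/
def Fset {k : ℕ} (Y : Matrix (Fin k) (Fin k) ℝ) (Vs : Fin k → ℝ) : Set (Fin k → ℝ) :=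
  {P | ∃ x, (∀ i, 0 < x i) ∧ Pc Y Vs x = P}

/-- `h(λ) = (1/2)([λ] Y + Y [λ])`. -/
def hmat {k : ℕ} (Y : Matrix (Fin k) (Fin k) ℝ) (l : Fin k → ℝ) : Matrix (Fin k) (Fin k) ℝ :=
  (1/2 : ℝ) • (Matrix.diagonal l * Y + Y * Matrix.diagonal l)

/-- `Λ₁ = {λ ∈ Λ : λ > 0, 1ᵀλ = 1}`. -/
def Lam1 {k : ℕ} (Y : Matrix (Fin k) (Fin k) ℝ) : Set (Fin k → ℝ) :=
  {l | (hmat Y l).PosDef ∧ (∀ i, 0 < l i) ∧ ∑ i, l i = 1}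

/-- `φ(λ) = (1/2) h(λ)⁻¹ [λ] I*` where `I* = Y V*`. -/
def phiv {k : ℕ} (Y : Matrix (Fin k) (Fin k) ℝ) (Vs : Fin k → ℝ) (l : Fin k → ℝ) : Fin k → ℝ :=
  (1/2 : ℝ) • ((hmat Y l)⁻¹ *ᵥ (Matrix.diagonal l *ᵥ (Y *ᵥ Vs)))

/-- `‖x‖_{h(λ)}²  = xᵀ h(λ) x`. -/
def qnorm {k : ℕ} (Y : Matrix (Fin k) (Fin k) ℝ) (l x : Fin k → ℝ) : ℝ :=
  x ⬝ᵥ (hmat Y l *ᵥ x)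

/-- The half-space `H_λ`. -/
def Hset {k : ℕ} (Y : Matrix (Fin k) (Fin k) ℝ) (Vs : Fin k → ℝ) (l : Fin k → ℝ) :
    Set (Fin k → ℝ) :=
  {y | l ⬝ᵥ y ≤ qnorm Y l (phiv Y Vs l)}



section helpers
variable {n : ℕ}

def Am (Y : Matrix (Fin n) (Fin n) ℝ) (Vs x : Fin n → ℝ) : Matrix (Fin n) (Fin n) ℝ :=
  -(Jmat Y Vs x)

lemma Pc_apply (Y : Matrix (Fin n) (Fin n) ℝ) (Vs x : Fin n → ℝ) (i : Fin n) :
    Pc Y Vs x i = x i * ((Y *ᵥ Vs) i - (Y *ᵥ x) i) := by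
  simp [Pc, Matrix.mulVec_diagonal, Matrix.mulVec_sub]

lemma Am_mulVec (Y : Matrix (Fin n) (Fin n) ℝ) (Vs x v : Fin n → ℝ) (i : Fin n) :
    (Am Y Vs x *ᵥ v) i = x i * (Y *ᵥ v) i + ((Y *ᵥ x) i - (Y *ᵥ Vs) i) * v i := by
  simp only [Am, Jmat, Matrix.neg_mulVec, Matrix.sub_mulVec, Pi.neg_apply, Pi.sub_apply,
    Matrix.mulVec_diagonal, ← Matrix.mulVec_mulVec, Matrix.mulVec_sub]
  ring

lemma Am_vecMul (Y : Matrix (Fin n) (Fin n) ℝ) (Vs x l : Fin n → ℝ) (j : Fin n) :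
    ((Am Y Vs x)ᵀ *ᵥ l) j = ∑ i, l i * x i * Y i j + l j * ((Y *ᵥ x) j - (Y *ᵥ Vs) j) := by
  rw [Matrix.mulVec_transpose]
  simp only [Am, Jmat, Matrix.vecMul_neg, Matrix.vecMul_sub, Pi.neg_apply, Pi.sub_apply,
    Matrix.vecMul_diagonal, ← Matrix.vecMul_vecMul, Matrix.mulVec_sub]
  simp only [Matrix.vecMul, dotProduct]
  simp [Matrix.diagonal, mul_comm]
  ring

lemma Am_off (Y : Matrix (Fin n) (Fin n) ℝ) (Vs x : Fin n → ℝ) {i j : Fin n} (h : i ≠ j) :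
    Am Y Vs x i j = x i * Y i j := by
  simp [Am, Jmat, Matrix.diagonal_mul, Matrix.diagonal_apply_ne _ h]

lemma Am_diag (Y : Matrix (Fin n) (Fin n) ℝ) (Vs x : Fin n → ℝ) (i : Fin n) :
    Am Y Vs x i i = x i * Y i i + ((Y *ᵥ x) i - (Y *ᵥ Vs) i) := by
  simp [Am, Jmat, Matrix.diagonal_mul, Matrix.mulVec_sub]
  ring

/-- expansion -/
lemma Pc_add (Y : Matrix (Fin n) (Fin n) ℝ) (Vs x d : Fin n → ℝ) (i : Fin n) :
    Pc Y Vs (x + d) i = Pc Y Vs x i - (Am Y Vs x *ᵥ d) i - d i * (Y *ᵥ d) i := by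
  rw [Pc_apply, Pc_apply, Am_mulVec, Matrix.mulVec_add]
  simp only [Pi.add_apply]
  ring

lemma Am_Z {Y : Matrix (Fin n) (Fin n) ℝ} (hZ : IsZmat Y) (Vs : Fin n → ℝ) {x : Fin n → ℝ}
    (hx : ∀ i, 0 < x i) : IsZmat (Am Y Vs x) := by
  intro i j h
  rw [Am_off _ _ _ h]
  exact mul_nonpos_of_nonneg_of_nonpos (hx i).le (hZ i j h)

lemma T_Z {B : Matrix (Fin n) (Fin n) ℝ} (hZ : IsZmat B) : IsZmat Bᵀ :=
  fun i j h => hZ j i h.symm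

lemma T_irr {B : Matrix (Fin n) (Fin n) ℝ} (h : IsIrred B) : IsIrred Bᵀ := by
  intro α h1 h2
  obtain ⟨i, hi, j, hj, hij⟩ := h αᶜ (by
      rw [Finset.nonempty_iff_ne_empty]; intro h; exact h2 (by simpa using h))
    (by intro h; rw [Finset.compl_eq_univ_iff] at h; exact h1.ne_empty h)
  exact ⟨j, by simpa using hj, i, hi, hij⟩

lemma Am_irr {Y : Matrix (Fin n) (Fin n) ℝ} (hI : IsIrred Y) (Vs : Fin n → ℝ) {x : Fin n → ℝ}
    (hx : ∀ i, 0 < x i) : IsIrred (Am Y Vs x) := by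
  intro α h1 h2
  obtain ⟨i, hi, j, hj, hij⟩ := hI α h1 h2
  refine ⟨i, hi, j, hj, ?_⟩
  rw [Am_off]
  · exact mul_ne_zero (hx i).ne' hij
  · rintro rfl; simp at hj; exact hj hi

/-- if `u ≥ 0` vanishes at `i` and `(B u)_i ≥ 0` then `B i j * u j = 0`. -/
lemma Z_zero {B : Matrix (Fin n) (Fin n) ℝ} (hZ : IsZmat B) {u : Fin n → ℝ} (hu : ∀ i, 0 ≤ u i)
    {i : Fin n} (h0 : u i = 0) (hB : 0 ≤ (B *ᵥ u) i) (j : Fin n) : B i j * u j = 0 := by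
  have hle : ∀ j ∈ Finset.univ, B i j * u j ≤ 0 := by
    intro j _
    by_cases h : i = j
    · subst h; simp [h0]
    · exact mul_nonpos_of_nonpos_of_nonneg (hZ i j h) (hu j)
  have hs : ∑ j, B i j * u j = 0 :=
    le_antisymm (Finset.sum_nonpos hle) (by simpa [Matrix.mulVec, dotProduct] using hB)
  exact (Finset.sum_eq_zero_iff_of_nonpos hle).1 hs j (Finset.mem_univ _)

/-- dichotomy -/
lemma Z_pos {B : Matrix (Fin n) (Fin n) ℝ} (hZ : IsZmat B) (hI : IsIrred B) {u : Fin n → ℝ}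
    (hu : ∀ i, 0 ≤ u i) (hB : ∀ i, u i = 0 → 0 ≤ (B *ᵥ u) i) : (∀ i, 0 < u i) ∨ u = 0 := by
  classical
  by_contra! hcon
  obtain ⟨⟨i, hi⟩, hne⟩ := hcon
  have hi0 : u i = 0 := le_antisymm hi (hu i)
  obtain ⟨a, ha, b, hb, hab⟩ := hI (Finset.univ.filter fun i => u i = 0) ⟨i, by simp [hi0]⟩
    (by
      intro h
      apply hne
      funext j
      have := Finset.mem_univ j
      rw [← h] at this
      simpa using this)
  have ha' : u a = 0 := by simpa using ha
  have hb' : u b ≠ 0 := by simpa using hb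
  have := Z_zero hZ hu ha' (hB a ha') b
  exact (mul_ne_zero hab hb') this

lemma M_dich (hn : 1 ≤ n) {B : Matrix (Fin n) (Fin n) ℝ} (hZ : IsZmat B) (hI : IsIrred B)
    {l : Fin n → ℝ} (hl : ∀ i, 0 < l i) (hBl : ∀ i, 0 ≤ (B *ᵥ l) i) (hBl0 : B *ᵥ l ≠ 0)
    {w : Fin n → ℝ} (hw : ∀ i, 0 ≤ (B *ᵥ w) i) : (∀ i, 0 < w i) ∨ w = 0 := by
  have : Nonempty (Fin n) := ⟨⟨0, hn⟩⟩
  obtain ⟨k, hk⟩ := Finite.exists_min (fun i => w i / l i)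
  set t := w k / l k with ht
  by_cases htp : 0 < t
  · left
    intro i
    have := hk i
    have h2 : 0 < w i / l i := htp.trans_le this
    rcases div_pos_iff.1 h2 with h | h
    · exact h.1
    · exact absurd (hl i) (not_lt.2 h.2.le)
  · push Not at htp
    have hu : ∀ i, 0 ≤ (w - t • l) i := by
      intro i
      have := hk i
      rw [le_div_iff₀ (hl i)] at this
      simpa using this
    have hBu : B *ᵥ (w - t • l) = B *ᵥ w - t • (B *ᵥ l) := by
      rw [Matrix.mulVec_sub, Matrix.mulVec_smul]
    have huk : (w - t • l) k = 0 := by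
      simp [ht, div_mul_cancel₀ _ (hl k).ne']
    rcases Z_pos hZ hI hu (by
      intro i _
      rw [hBu]
      simp only [Pi.sub_apply, Pi.smul_apply, smul_eq_mul]
      nlinarith [hw i, mul_nonneg (neg_nonneg.2 htp) (hBl i)]) with h | h
    · exact absurd huk (h k).ne'
    · rw [sub_eq_zero] at h
      right
      have : t = 0 := by
        by_contra hne
        have htn : t < 0 := lt_of_le_of_ne htp hne
        apply hBl0
        funext i
        have h1 := hw i
        rw [h, Matrix.mulVec_smul] at h1
        simp only [Pi.smul_apply, smul_eq_mul] at h1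
        have h2 := hBl i
        simp only [Pi.zero_apply]
        nlinarith
      rw [h, this, zero_smul]

lemma M_inv (hn : 1 ≤ n) {B : Matrix (Fin n) (Fin n) ℝ} (hZ : IsZmat B) (hI : IsIrred B)
    {l : Fin n → ℝ} (hl : ∀ i, 0 < l i) (hBl : ∀ i, 0 ≤ (B *ᵥ l) i) (hBl0 : B *ᵥ l ≠ 0) :
    IsUnit B.det ∧ ∀ i j, 0 < B⁻¹ i j := by
  have hinj : ∀ w, B *ᵥ w = 0 → w = 0 := by
    intro w hw
    rcases M_dich hn hZ hI hl hBl hBl0 (w := w) (by simp [hw]) with h | h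
    · rcases M_dich hn hZ hI hl hBl hBl0 (w := -w) (by simp [hw, Matrix.mulVec_neg]) with h' | h'
      · have h1 := h ⟨0, hn⟩
        have h2 := h' ⟨0, hn⟩
        simp only [Pi.neg_apply] at h2
        linarith
      · simpa using h'
    · exact h
  have hdet : IsUnit B.det := by
    rw [isUnit_iff_ne_zero]
    intro h0
    obtain ⟨v, hv, hv0⟩ := Matrix.exists_mulVec_eq_zero_iff.2 h0
    exact hv (hinj v hv0)
  refine ⟨hdet, fun i j => ?_⟩
  have hc : B *ᵥ (B⁻¹ *ᵥ Pi.single j 1) = Pi.single j 1 := by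
    rw [Matrix.mulVec_mulVec, Matrix.mul_nonsing_inv _ hdet, Matrix.one_mulVec]
  rcases M_dich hn hZ hI hl hBl hBl0 (w := B⁻¹ *ᵥ Pi.single j 1) (by
    intro i; rw [hc]; by_cases h : i = j
    · subst h; simp
    · simp [h]) with h | h
  · simpa using h i
  · rw [h] at hc
    have := congrFun hc j
    simp at this

lemma mem_D_right (hn : 1 ≤ n) {Y : Matrix (Fin n) (Fin n) ℝ} (hZ : IsZmat Y) (hI : IsIrred Y)
    {Vs x l : Fin n → ℝ} (hx : ∀ i, 0 < x i)
    (hl : ∀ i, 0 < l i) (h1 : ∀ i, 0 ≤ (Am Y Vs x *ᵥ l) i) (h2 : Am Y Vs x *ᵥ l ≠ 0) :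
    x ∈ Dset Y Vs := by
  obtain ⟨ha, hb⟩ := M_inv hn (Am_Z hZ Vs hx) (Am_irr hI Vs hx) hl h1 h2
  have hJ : Jmat Y Vs x = - Am Y Vs x := by simp [Am]
  have hinv : (Jmat Y Vs x)⁻¹ = -(Am Y Vs x)⁻¹ := by
    apply Matrix.inv_eq_right_inv
    rw [hJ, neg_mul_neg, Matrix.mul_nonsing_inv _ ha]
  refine ⟨hx, ?_, fun i j => ?_⟩
  · rw [hJ, Matrix.det_neg]
    exact ((isUnit_one.neg).pow _).mul ha
  · rw [hinv]; simpa using hb i j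

lemma mem_D_left (hn : 1 ≤ n) {Y : Matrix (Fin n) (Fin n) ℝ} (hZ : IsZmat Y) (hI : IsIrred Y)
    {Vs x l : Fin n → ℝ} (hx : ∀ i, 0 < x i)
    (hl : ∀ i, 0 < l i) (h1 : ∀ i, 0 ≤ ((Am Y Vs x)ᵀ *ᵥ l) i) (h2 : (Am Y Vs x)ᵀ *ᵥ l ≠ 0) :
    x ∈ Dset Y Vs := by
  obtain ⟨ha, hb⟩ := M_inv hn (T_Z (Am_Z hZ Vs hx)) (T_irr (Am_irr hI Vs hx)) hl h1 h2
  rw [Matrix.det_transpose] at ha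
  have hJ : Jmat Y Vs x = - Am Y Vs x := by simp [Am]
  have hinv : (Jmat Y Vs x)⁻¹ = -(Am Y Vs x)⁻¹ := by
    apply Matrix.inv_eq_right_inv
    rw [hJ, neg_mul_neg, Matrix.mul_nonsing_inv _ ha]
  refine ⟨hx, ?_, fun i j => ?_⟩
  · rw [hJ, Matrix.det_neg]
    exact ((isUnit_one.neg).pow _).mul ha
  · rw [hinv]
    have := hb j i
    rw [← Matrix.transpose_nonsing_inv] at this
    simpa using this

lemma D_inv_pos {Y : Matrix (Fin n) (Fin n) ℝ} {Vs x : Fin n → ℝ} (hx : x ∈ Dset Y Vs) :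
    IsUnit (Am Y Vs x).det ∧ ∀ i j, 0 < (Am Y Vs x)⁻¹ i j := by
  obtain ⟨h0, hu, hn⟩ := hx
  have hinv : (Am Y Vs x)⁻¹ = -(Jmat Y Vs x)⁻¹ := by
    apply Matrix.inv_eq_right_inv
    rw [Am, neg_mul_neg, Matrix.mul_nonsing_inv _ hu]
  constructor
  · rw [Am, Matrix.det_neg]
    exact ((isUnit_one.neg).pow _).mul hu
  · intro i j
    rw [hinv]
    simpa using hn i j

lemma D_exists_w (hn : 1 ≤ n) {Y : Matrix (Fin n) (Fin n) ℝ} {Vs x : Fin n → ℝ}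
    (hx : x ∈ Dset Y Vs) :
    ∃ w : Fin n → ℝ, (∀ i, 0 < w i) ∧ Am Y Vs x *ᵥ w = fun _ => 1 := by
  obtain ⟨hu, hp⟩ := D_inv_pos hx
  refine ⟨(Am Y Vs x)⁻¹ *ᵥ fun _ => 1, fun i => ?_, ?_⟩
  · simp only [Matrix.mulVec, dotProduct, mul_one]
    exact Finset.sum_pos (fun j _ => hp i j) ⟨⟨0, hn⟩, Finset.mem_univ _⟩
  · rw [Matrix.mulVec_mulVec, Matrix.mul_nonsing_inv _ hu, Matrix.one_mulVec]

lemma D_diag (hn : 1 ≤ n) {Y : Matrix (Fin n) (Fin n) ℝ} (hZ : IsZmat Y) {Vs x : Fin n → ℝ}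
    (hx : x ∈ Dset Y Vs) (i : Fin n) : 0 ≤ Am Y Vs x i i := by
  obtain ⟨w, hw, hA⟩ := D_exists_w hn hx
  have h1 := congrFun hA i
  simp only [Matrix.mulVec, dotProduct] at h1
  rw [← Finset.add_sum_erase _ _ (Finset.mem_univ i)] at h1
  have : ∑ j ∈ Finset.univ.erase i, Am Y Vs x i j * w j ≤ 0 := by
    apply Finset.sum_nonpos
    intro j hj
    exact mul_nonpos_of_nonpos_of_nonneg
      (Am_Z hZ Vs hx.1 i j (Finset.ne_of_mem_erase hj).symm) (hw j).le
  by_contra! hneg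
  nlinarith [hw i, mul_neg_of_neg_of_pos hneg (hw i)]

lemma quad_pos {Y : Matrix (Fin n) (Fin n) ℝ} (hZ : IsZmat Y) (hI : IsIrred Y)
    {Vs x l d : Fin n → ℝ} (hInn : ∀ i, 0 ≤ (Y *ᵥ Vs) i) (hIne : Y *ᵥ Vs ≠ 0)
    (hx : ∀ i, 0 < x i) (hl : ∀ i, 0 < l i) (hA : (Am Y Vs x)ᵀ *ᵥ l = 0) (hd : d ≠ 0) :
    0 < ∑ i, l i * (d i * (Y *ᵥ d) i) := by
  classical
  obtain ⟨e, he⟩ : ∃ e : Fin n → ℝ, ∀ i, d i = x i * e i :=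
    ⟨fun i => d i / x i, fun i => by field_simp [(hx i).ne']⟩
  set M : Fin n → Fin n → ℝ := fun i j => l i * x i * Y i j * x j with hM
  have hQ : ∑ i, l i * (d i * (Y *ᵥ d) i) = ∑ i, ∑ j, M i j * (e i * e j) := by
    refine Finset.sum_congr rfl fun i _ => ?_
    simp only [Matrix.mulVec, dotProduct, Finset.mul_sum]
    refine Finset.sum_congr rfl fun j _ => ?_
    rw [he i, he j, hM]; ring
  have hR : ∑ i, ∑ j, M i j * (e j ^ 2) + ∑ i, ∑ j, M i j * e i ^ 2
      = ∑ j, l j * (Y *ᵥ Vs) j * x j * e j ^ 2 := by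
    rw [Finset.sum_comm, ← Finset.sum_add_distrib]
    refine Finset.sum_congr rfl fun j _ => ?_
    have h := congrFun hA j
    rw [Am_vecMul] at h
    have h1 : ∑ i, M i j * e j ^ 2 = (∑ i, l i * x i * Y i j) * (x j * e j ^ 2) := by
      rw [Finset.sum_mul]
      exact Finset.sum_congr rfl fun i _ => by rw [hM]; ring
    have h2 : ∑ i, M j i * e j ^ 2 = l j * (Y *ᵥ x) j * (x j * e j ^ 2) := by
      simp only [Matrix.mulVec, dotProduct, Finset.mul_sum, Finset.sum_mul]
      exact Finset.sum_congr rfl fun i _ => by rw [hM]; ring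
    rw [h1, h2]
    simp only [Pi.zero_apply] at h
    linear_combination (x j * e j ^ 2) * h
  have hS : 2 * ∑ i, ∑ j, M i j * (e i * e j) =
      ∑ j, l j * (Y *ᵥ Vs) j * x j * e j ^ 2 + ∑ i, ∑ j, -(M i j) * (e i - e j) ^ 2 := by
    rw [← hR, Finset.mul_sum, ← Finset.sum_add_distrib, ← Finset.sum_add_distrib]
    refine Finset.sum_congr rfl fun i _ => ?_
    rw [Finset.mul_sum, ← Finset.sum_add_distrib, ← Finset.sum_add_distrib]
    refine Finset.sum_congr rfl fun j _ => ?_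
    ring
  have hMn : ∀ i j, 0 ≤ -(M i j) * (e i - e j) ^ 2 := by
    intro i j
    by_cases h : i = j
    · subst h; simp
    · apply mul_nonneg _ (sq_nonneg _)
      have : M i j ≤ 0 := by
        rw [hM]
        exact mul_nonpos_of_nonpos_of_nonneg
          (mul_nonpos_of_nonneg_of_nonpos (mul_pos (hl i) (hx i)).le (hZ i j h)) (hx j).le
      linarith
  have hRn : ∀ j, 0 ≤ l j * (Y *ᵥ Vs) j * x j * e j ^ 2 := fun j =>
    mul_nonneg (mul_nonneg (mul_nonneg (hl j).le (hInn j)) (hx j).le) (sq_nonneg _)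
  have s1 : 0 ≤ ∑ j, l j * (Y *ᵥ Vs) j * x j * e j ^ 2 := Finset.sum_nonneg fun j _ => hRn j
  have s2 : 0 ≤ ∑ i, ∑ j, -(M i j) * (e i - e j) ^ 2 :=
    Finset.sum_nonneg fun i _ => Finset.sum_nonneg fun j _ => hMn i j
  rw [hQ]
  by_contra! hcon
  have z1 : ∑ j, l j * (Y *ᵥ Vs) j * x j * e j ^ 2 = 0 := by linarith
  have z2 : ∑ i, ∑ j, -(M i j) * (e i - e j) ^ 2 = 0 := by linarith
  rw [Finset.sum_eq_zero_iff_of_nonneg (fun j _ => hRn j)] at z1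
  rw [Finset.sum_eq_zero_iff_of_nonneg
    (fun i _ => Finset.sum_nonneg fun j _ => hMn i j)] at z2
  obtain ⟨k, hk⟩ : ∃ k, (Y *ᵥ Vs) k ≠ 0 := by
    by_contra! h
    exact hIne (funext h)
  have hek : e k = 0 := by
    have := z1 k (Finset.mem_univ _)
    simpa [(hl k).ne', (hx k).ne', hk] using this
  have hall : ∀ i, e i = 0 := by
    by_contra! hne
    obtain ⟨i0, hi0⟩ := hne
    obtain ⟨a, ha, b, hb, hab⟩ := hI (Finset.univ.filter fun i => e i = 0) ⟨k, by simp [hek]⟩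
      (by
        intro h
        have := Finset.mem_univ i0
        rw [← h] at this
        exact hi0 (by simpa using this))
    have ha' : e a = 0 := by simpa using ha
    have hb' : e b ≠ 0 := by simpa using hb
    have h1 := (Finset.sum_eq_zero_iff_of_nonneg (fun j _ => hMn a j)).1
      (z2 a (Finset.mem_univ _)) b (Finset.mem_univ _)
    rw [ha', hM] at h1
    simp [(hl a).ne', (hx a).ne', (hx b).ne', hab, hb'] at h1
  apply hd
  funext i
  rw [he i, hall i]; simp

lemma max_strict {Y : Matrix (Fin n) (Fin n) ℝ} (hZ : IsZmat Y) (hI : IsIrred Y)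
    {Vs x l z : Fin n → ℝ} (hInn : ∀ i, 0 ≤ (Y *ᵥ Vs) i) (hIne : Y *ᵥ Vs ≠ 0)
    (hx : ∀ i, 0 < x i) (hl : ∀ i, 0 < l i) (hA : (Am Y Vs x)ᵀ *ᵥ l = 0) (hd : z ≠ x) :
    ∑ i, l i * Pc Y Vs z i < ∑ i, l i * Pc Y Vs x i := by
  have hq := quad_pos hZ hI hInn hIne hx hl hA (sub_ne_zero.2 hd)
  have hz : z = x + (z - x) := by abel
  have h0 : ∑ i, l i * (Am Y Vs x *ᵥ (z - x)) i = 0 := by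
    change l ⬝ᵥ (Am Y Vs x *ᵥ (z - x)) = 0
    rw [Matrix.dotProduct_mulVec, ← Matrix.mulVec_transpose, hA, zero_dotProduct]
  have : ∑ i, l i * Pc Y Vs z i = ∑ i, l i * Pc Y Vs x i
      - ∑ i, l i * (Am Y Vs x *ᵥ (z - x)) i - ∑ i, l i * ((z - x) i * (Y *ᵥ (z - x)) i) := by
    rw [← Finset.sum_sub_distrib, ← Finset.sum_sub_distrib]
    refine Finset.sum_congr rfl fun i _ => ?_
    conv_lhs => rw [hz, Pc_add]
    ring
  rw [this, h0]
  linarith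

lemma gordan (A : Matrix (Fin n) (Fin n) ℝ) :
    (∃ v, ∀ i, (A *ᵥ v) i < 0) ∨ ∃ l : Fin n → ℝ, (∀ i, 0 ≤ l i) ∧ l ≠ 0 ∧ Aᵀ *ᵥ l = 0 := by
  classical
  by_cases hex : ∃ v, ∀ i, (A *ᵥ v) i < 0
  · exact Or.inl hex
  right
  let s : Set (Fin n → ℝ) := {y | ∀ i, y i < 0}
  let t : Set (Fin n → ℝ) := (LinearMap.range A.mulVecLin : Submodule ℝ (Fin n → ℝ))
  have hs : Convex ℝ s := by
    have : s = Set.univ.pi fun _ => Set.Iio (0:ℝ) := by ext; simp [s]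
    rw [this]
    exact convex_pi fun i _ => convex_Iio 0
  have hso : IsOpen s := by
    have : s = Set.univ.pi fun _ => Set.Iio (0:ℝ) := by ext; simp [s]
    rw [this]
    exact isOpen_set_pi Set.finite_univ fun i _ => isOpen_Iio
  have ht : Convex ℝ t := Submodule.convex _
  have hdis : Disjoint s t := by
    rw [Set.disjoint_left]
    rintro y hy ⟨v, rfl⟩
    exact hex ⟨v, hy⟩
  obtain ⟨f, u, hfs, hft⟩ := geometric_hahn_banach_open hs hso ht hdis
  have hu : u ≤ 0 := by simpa using hft 0 (Submodule.zero_mem _)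
  have hf0 : ∀ v, f (A *ᵥ v) = 0 := by
    intro v
    by_contra hne
    have h1 := hft (A *ᵥ (((u - 1) / f (A *ᵥ v)) • v)) ⟨_, rfl⟩
    rw [Matrix.mulVec_smul, map_smul, smul_eq_mul, div_mul_cancel₀ _ hne] at h1
    linarith
  have hfl : ∀ y, f y = ∑ i, f (Pi.single i 1) * y i := by
    intro y
    conv_lhs => rw [← Finset.univ_sum_single y, map_sum]
    refine Finset.sum_congr rfl fun i _ => ?_
    have : (Pi.single i (y i) : Fin n → ℝ) = y i • Pi.single i 1 := by
      rw [← Pi.single_smul]; simp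
    rw [this, map_smul, smul_eq_mul, mul_comm]
  have hneg : f (fun _ => -1) < 0 := lt_of_lt_of_le (hfs _ (fun i => by norm_num)) hu
  refine ⟨fun i => f (Pi.single i 1), fun i => ?_, ?_, ?_⟩
  · by_contra! hi
    -- y = -ε off i, -1 at i
    have hcl : ∀ ε : ℝ, 0 < ε → f (-Pi.single i 1) + ε * f (fun _ => -1) < 0 := by
      intro ε hε
      rw [← smul_eq_mul, ← map_smul, ← map_add]
      refine lt_of_lt_of_le (hfs _ (fun j => ?_)) hu
      by_cases h : j = i
      · subst h; simp; linarith
      · simp [h]; exact hε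
    rw [map_neg] at hcl
    have h2 := hcl (f (Pi.single i 1) / f (fun _ => -1)) (div_pos_of_neg_of_neg hi hneg)
    rw [div_mul_cancel₀ _ hneg.ne] at h2
    linarith
  · intro h0
    have : f (fun _ => -1) = 0 := by
      rw [hfl]
      exact Finset.sum_eq_zero fun i _ => by rw [show f (Pi.single i 1) = 0 from congrFun h0 i]; simp
    linarith
  · funext j
    have := hf0 (Pi.single j 1)
    rw [hfl] at this
    rw [Matrix.mulVec_transpose]
    simpa [Matrix.vecMul, dotProduct] using this

lemma mem_D_neg (hn : 1 ≤ n) {Y : Matrix (Fin n) (Fin n) ℝ} (hZ : IsZmat Y) (hI : IsIrred Y)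
    {Vs x v : Fin n → ℝ} (hx : ∀ i, 0 < x i)
    (hv : ∀ i, v i ≤ 0) (h1 : ∀ i, (Am Y Vs x *ᵥ v) i < 0) :
    x ∈ Dset Y Vs := by
  have h2 : ∀ i, 0 < (Am Y Vs x *ᵥ (-v)) i := fun i => by
    rw [Matrix.mulVec_neg]; simpa using h1 i
  have hne : Am Y Vs x *ᵥ (-v) ≠ 0 := fun h => by
    have := h2 ⟨0, hn⟩
    rw [h] at this; simp at this
  refine mem_D_right hn hZ hI hx (l := -v) ?_ (fun i => (h2 i).le) hne
  rcases Z_pos (Am_Z hZ Vs hx) (Am_irr hI Vs hx) (u := -v) (fun i => by simpa using hv i)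
    (fun i _ => (h2 i).le) with h | h
  · exact h
  · rw [h] at hne; simp at hne

lemma alt (hn : 1 ≤ n) {Y : Matrix (Fin n) (Fin n) ℝ} (hZ : IsZmat Y) (hI : IsIrred Y)
    (Vs : Fin n → ℝ) {x : Fin n → ℝ} (hx : ∀ i, 0 < x i) :
    (∃ v, ∀ i, (Am Y Vs x *ᵥ v) i < 0) ∨
      ∃ l : Fin n → ℝ, (∀ i, 0 < l i) ∧ (Am Y Vs x)ᵀ *ᵥ l = 0 := by
  rcases gordan (Am Y Vs x) with h | ⟨l, hl, hl0, h⟩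
  · exact Or.inl h
  · rcases Z_pos (T_Z (Am_Z hZ Vs hx)) (T_irr (Am_irr hI Vs hx)) hl (fun i _ => by simp [h])
      with h' | h'
    · exact Or.inr ⟨l, h', h⟩
    · exact absurd h' hl0

lemma mem_cl_D (hn : 1 ≤ n) {Y : Matrix (Fin n) (Fin n) ℝ} (hZ : IsZmat Y) (hI : IsIrred Y)
    {Vs x l : Fin n → ℝ} (hInn : ∀ i, 0 ≤ (Y *ᵥ Vs) i) (hIne : Y *ᵥ Vs ≠ 0)
    (hx : ∀ i, 0 < x i) (hl : ∀ i, 0 < l i) (hA : (Am Y Vs x)ᵀ *ᵥ l = 0) :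
    x ∈ closure (Dset Y Vs) := by
  have key : ∀ ε : ℝ, 0 < ε → (1 + ε) • x ∈ Dset Y Vs := by
    intro ε hε
    have hc : ∀ j, ((Am Y Vs ((1 + ε) • x))ᵀ *ᵥ l) j = ε * (l j * (Y *ᵥ Vs) j) := by
      intro j
      have h := congrFun hA j
      rw [Am_vecMul] at h ⊢
      rw [Matrix.mulVec_smul]
      simp only [Pi.smul_apply, smul_eq_mul, Pi.zero_apply] at h ⊢
      have : ∑ i, l i * ((1 + ε) * x i) * Y i j = (1 + ε) * ∑ i, l i * x i * Y i j := by
        rw [Finset.mul_sum]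
        exact Finset.sum_congr rfl fun i _ => by ring
      rw [this]
      linear_combination (1 + ε) * h
    refine mem_D_left hn hZ hI (fun i => ?_) hl (fun j => ?_) ?_
    · simp only [Pi.smul_apply, smul_eq_mul]
      have := hx i
      positivity
    · rw [hc]
      exact mul_nonneg hε.le (mul_nonneg (hl j).le (hInn j))
    · intro h0
      apply hIne
      funext j
      have := hc j
      rw [h0] at this
      simpa [hε.ne', (hl j).ne'] using this.symm
  have ht : Filter.Tendsto (fun ε : ℝ => (1 + ε) • x) (nhdsWithin 0 (Set.Ioi 0)) (nhds x) := by
    have : Continuous fun ε : ℝ => (1 + ε) • x := by fun_prop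
    have h := this.tendsto 0
    simp only [add_zero, one_smul] at h
    exact h.mono_left nhdsWithin_le_nhds
  exact mem_closure_of_tendsto ht (by
    filter_upwards [self_mem_nhdsWithin] with ε hε using key ε hε)

lemma cont_Am (Y : Matrix (Fin n) (Fin n) ℝ) (Vs v : Fin n → ℝ) (i : Fin n) :
    Continuous fun x => (Am Y Vs x *ᵥ v) i := by
  simp only [Am_mulVec]
  simp only [Matrix.mulVec, dotProduct]
  fun_prop

lemma cont_Pc (Y : Matrix (Fin n) (Fin n) ℝ) (Vs : Fin n → ℝ) : Continuous (Pc Y Vs) := by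
  refine continuous_pi fun i => ?_
  simp only [Pc_apply]
  simp only [Matrix.mulVec, dotProduct]
  fun_prop

lemma D_open (hn : 1 ≤ n) {Y : Matrix (Fin n) (Fin n) ℝ} (hZ : IsZmat Y) (hI : IsIrred Y)
    (Vs : Fin n → ℝ) : IsOpen (Dset Y Vs) := by
  rw [isOpen_iff_mem_nhds]
  intro x hx
  obtain ⟨w, hw, hA⟩ := D_exists_w hn hx
  have e1 : ∀ᶠ y in nhds x, ∀ i, 0 < y i := by
    rw [Filter.eventually_all]
    exact fun i => (continuous_apply i).continuousAt.eventually (lt_mem_nhds (hx.1 i))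
  have e2 : ∀ᶠ y in nhds x, ∀ i, 0 < (Am Y Vs y *ᵥ w) i := by
    rw [Filter.eventually_all]
    exact fun i => (cont_Am Y Vs w i).continuousAt.eventually
      (lt_mem_nhds (by simp only [hA]; norm_num))
  filter_upwards [e1, e2] with y h1 h2
  exact mem_D_right hn hZ hI h1 hw (fun i => (h2 i).le) (fun h => by
    have := h2 ⟨0, hn⟩; rw [h] at this; simp at this)

lemma cl_D_pos (hn : 1 ≤ n) {Y : Matrix (Fin n) (Fin n) ℝ} (hZ : IsZmat Y) (hI : IsIrred Y)
    {Vs x : Fin n → ℝ} (hInn : ∀ i, 0 ≤ (Y *ᵥ Vs) i) (hIne : Y *ᵥ Vs ≠ 0)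
    (hx : x ∈ closure (Dset Y Vs)) : ∀ i, 0 < x i := by
  have hcl : IsClosed {y : Fin n → ℝ | ∀ i, 0 ≤ y i ∧ 0 ≤ Am Y Vs y i i} := by
    have : {y : Fin n → ℝ | ∀ i, 0 ≤ y i ∧ 0 ≤ Am Y Vs y i i} =
        ⋂ i, ({y : Fin n → ℝ | 0 ≤ y i} ∩ {y | 0 ≤ Am Y Vs y i i}) := by
      ext y; simp
    rw [this]
    refine isClosed_iInter fun i => ?_
    have c1 : Continuous fun y : Fin n → ℝ => Am Y Vs y i i := by
      simp only [Am_diag, Matrix.mulVec, dotProduct]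
      fun_prop
    exact (isClosed_le continuous_const (continuous_apply i)).inter
      (isClosed_le continuous_const c1)
  have hx' := closure_minimal (fun y hy i => ⟨(hy.1 i).le, D_diag hn hZ hy i⟩) hcl hx
  rcases Z_pos hZ hI (u := x) (fun i => (hx' i).1) (fun i hi => by
    have := (hx' i).2
    rw [Am_diag, hi] at this
    have := hInn i
    linarith) with h | h
  · exact h
  · exfalso
    apply hIne
    funext i
    have := (hx' i).2
    rw [Am_diag, h] at this
    simp at this
    exact le_antisymm this (hInn i)

lemma fr_D (hn : 1 ≤ n) {Y : Matrix (Fin n) (Fin n) ℝ} (hZ : IsZmat Y) (hI : IsIrred Y)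
    {Vs x : Fin n → ℝ} (hInn : ∀ i, 0 ≤ (Y *ᵥ Vs) i) (hIne : Y *ᵥ Vs ≠ 0)
    (hx : x ∈ frontier (Dset Y Vs)) :
    (∀ i, 0 < x i) ∧ ∃ l : Fin n → ℝ, (∀ i, 0 < l i) ∧ (Am Y Vs x)ᵀ *ᵥ l = 0 := by
  rw [(D_open hn hZ hI Vs).frontier_eq] at hx
  have hp := cl_D_pos hn hZ hI hInn hIne hx.1
  refine ⟨hp, ?_⟩
  rcases alt hn hZ hI Vs hp with ⟨v, hv⟩ | h
  · exfalso
    have e2 : ∀ᶠ y in nhds x, ∀ i, (Am Y Vs y *ᵥ v) i < 0 := by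
      rw [Filter.eventually_all]
      exact fun i => (cont_Am Y Vs v i).continuousAt.eventually (gt_mem_nhds (hv i))
    obtain ⟨y, hyv, hyD⟩ := mem_closure_iff_nhds.1 hx.1 _ e2
    obtain ⟨hu, hpos⟩ := D_inv_pos hyD
    apply hx.2
    refine mem_D_neg hn hZ hI hp (v := v) (fun i => ?_) hv
    have : v = (Am Y Vs y)⁻¹ *ᵥ (Am Y Vs y *ᵥ v) := by
      rw [Matrix.mulVec_mulVec, Matrix.nonsing_inv_mul _ hu, Matrix.one_mulVec]
    rw [this]
    simp only [Matrix.mulVec, dotProduct]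
    refine Finset.sum_nonpos fun j _ => mul_nonpos_of_nonneg_of_nonpos (hpos i j).le ?_
    exact (hyv j).le
  · exact h

lemma bnd {Y : Matrix (Fin n) (Fin n) ℝ} (hPD : Y.PosDef) (Vs : Fin n → ℝ) (c : ℝ) :
    ∃ C : ℝ, ∀ y : Fin n → ℝ, (∀ i, 0 ≤ y i) → c ≤ ∑ i, Pc Y Vs y i → ∀ i, y i ≤ C := by
  have hu : IsUnit Y.det := isUnit_iff_ne_zero.2 hPD.det_pos.ne'
  set s : Fin n → ℝ := Y⁻¹ *ᵥ ((1/2 : ℝ) • (Y *ᵥ Vs + fun _ => 1)) with hs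
  have hYs : Y *ᵥ s = (1/2 : ℝ) • (Y *ᵥ Vs + fun _ => 1) := by
    rw [hs, Matrix.mulVec_mulVec, Matrix.mul_nonsing_inv _ hu, Matrix.one_mulVec]
  refine ⟨s ⬝ᵥ (Y *ᵥ s) - c, fun y hy hc i => ?_⟩
  have h1 : 0 ≤ (y - s) ⬝ᵥ (Y *ᵥ (y - s)) := by
    simpa using hPD.posSemidef.dotProduct_mulVec_nonneg (y - s)
  have hsym : s ⬝ᵥ (Y *ᵥ y) = y ⬝ᵥ (Y *ᵥ s) := by
    have ht : Yᵀ = Y := by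
      ext i j
      have := congrFun (congrFun hPD.isHermitian i) j
      simpa [Matrix.conjTranspose] using this
    rw [Matrix.dotProduct_mulVec, ← Matrix.mulVec_transpose, ht, dotProduct_comm]
  rw [Matrix.mulVec_sub, dotProduct_sub, sub_dotProduct, sub_dotProduct, hsym] at h1
  have h2 : y ⬝ᵥ (Y *ᵥ s) = (1/2) * (y ⬝ᵥ (Y *ᵥ Vs) + ∑ i, y i) := by
    rw [hYs, dotProduct_smul, dotProduct_add, smul_eq_mul]
    simp [dotProduct]
  have h3 : ∑ i, Pc Y Vs y i = y ⬝ᵥ (Y *ᵥ Vs) - y ⬝ᵥ (Y *ᵥ y) := by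
    simp only [Pc_apply, dotProduct, ← Finset.sum_sub_distrib]
    exact Finset.sum_congr rfl fun i _ => by ring
  have h4 : y i ≤ ∑ i, y i := Finset.single_le_sum (fun j _ => hy j) (Finset.mem_univ i)
  linarith

lemma ascent {Y : Matrix (Fin n) (Fin n) ℝ} {Vs x v : Fin n → ℝ} (hx : ∀ i, 0 < x i)
    (hv : ∀ i, (Am Y Vs x *ᵥ v) i < 0) :
    ∃ ε : ℝ, 0 < ε ∧ (∀ i, 0 < (x + ε • v) i) ∧ ∀ i, Pc Y Vs x i < Pc Y Vs (x + ε • v) i := by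
  have e1 : ∀ᶠ ε in nhdsWithin (0:ℝ) (Set.Ioi 0), ∀ i, 0 < (x + ε • v) i := by
    rw [Filter.eventually_all]
    intro i
    have hc : Continuous fun ε : ℝ => (x + ε • v) i := by
      simp only [Pi.add_apply, Pi.smul_apply]; fun_prop
    exact (hc.continuousAt.eventually (lt_mem_nhds (by simpa using hx i))).filter_mono
      nhdsWithin_le_nhds
  have e2 : ∀ᶠ ε in nhdsWithin (0:ℝ) (Set.Ioi 0), ∀ i,
      0 < -(Am Y Vs x *ᵥ v) i - ε * (v i * (Y *ᵥ v) i) := by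
    rw [Filter.eventually_all]
    intro i
    have hc : Continuous fun ε : ℝ => -(Am Y Vs x *ᵥ v) i - ε * (v i * (Y *ᵥ v) i) := by
      fun_prop
    exact (hc.continuousAt.eventually (lt_mem_nhds (by simpa using hv i))).filter_mono
      nhdsWithin_le_nhds
  obtain ⟨ε, h1, h2, h3⟩ := (e1.and (e2.and self_mem_nhdsWithin)).exists
  have hε : 0 < ε := h3
  refine ⟨ε, hε, h1, fun i => ?_⟩
  rw [Pc_add, Matrix.mulVec_smul, Matrix.mulVec_smul]
  simp only [Pi.smul_apply, smul_eq_mul]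
  nlinarith [mul_pos hε (h2 i)]

lemma mulVec_mono_off {Y : Matrix (Fin n) (Fin n) ℝ} (hZ : IsZmat Y) {y z : Fin n → ℝ}
    (h : ∀ j, y j ≤ z j) {i : Fin n} (hi : y i = z i) : (Y *ᵥ z) i ≤ (Y *ᵥ y) i := by
  simp only [Matrix.mulVec, dotProduct]
  refine Finset.sum_le_sum fun j _ => ?_
  by_cases hij : i = j
  · subst hij; rw [hi]
  · exact mul_le_mul_of_nonpos_left (h j) (hZ i j hij)

lemma Pc_mono_off {Y : Matrix (Fin n) (Fin n) ℝ} (hZ : IsZmat Y) {Vs y z : Fin n → ℝ}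
    (h : ∀ j, y j ≤ z j) {i : Fin n} (hi : y i = z i) (hy : 0 < y i) :
    Pc Y Vs y i ≤ Pc Y Vs z i := by
  rw [Pc_apply, Pc_apply, ← hi]
  have := mulVec_mono_off hZ h hi
  exact mul_le_mul_of_nonneg_left (by linarith) hy.le

lemma exists_sol (hn : 1 ≤ n) {Y : Matrix (Fin n) (Fin n) ℝ} (hPD : Y.PosDef)
    (hZ : IsZmat Y) (hI : IsIrred Y)
    {Vs x P : Fin n → ℝ} (hInn : ∀ i, 0 ≤ (Y *ᵥ Vs) i) (hIne : Y *ᵥ Vs ≠ 0)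
    (hx : ∀ i, 0 < x i) (hP : ∀ i, P i ≤ Pc Y Vs x i) :
    ∃ m ∈ closure (Dset Y Vs), (∀ i, 0 < m i) ∧ Pc Y Vs m = P := by
  classical
  let S : Set (Fin n → ℝ) := Set.Ici x ∩ Pc Y Vs ⁻¹' Set.Ici P
  have hScl : IsClosed S := isClosed_Ici.inter (isClosed_Ici.preimage (cont_Pc Y Vs))
  obtain ⟨C, hC⟩ := bnd hPD Vs (∑ i, P i)
  have hSc : IsCompact S := by
    refine IsCompact.of_isClosed_subset (isCompact_Icc (a := x) (b := fun _ => C)) hScl ?_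
    rintro y ⟨h1, h2⟩
    exact ⟨h1, hC y (fun i => (hx i).le.trans (h1 i)) (Finset.sum_le_sum fun i _ => h2 i)⟩
  obtain ⟨m, hmS, hmax⟩ := hSc.exists_isMaxOn ⟨x, le_refl x, hP⟩
    (f := fun y : Fin n → ℝ => ∑ i, y i) (by fun_prop)
  have hmx : ∀ i, x i ≤ m i := hmS.1
  have hmP : ∀ i, P i ≤ Pc Y Vs m i := hmS.2
  have hm0 : ∀ i, 0 < m i := fun i => (hx i).trans_le (hmx i)
  have great : ∀ z : Fin n → ℝ, (∀ i, 0 < z i) → (∀ i, P i ≤ Pc Y Vs z i) → ∀ i, z i ≤ m i := by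
    intro z hz hzP
    have hsup : m ⊔ z ∈ S := by
      refine ⟨fun i => (hmx i).trans le_sup_left, fun i => ?_⟩
      rcases le_total (z i) (m i) with h | h
      · exact (hmP i).trans (Pc_mono_off hZ (fun j => by simp) (by simp [h]) (hm0 i))
      · exact (hzP i).trans (Pc_mono_off hZ (fun j => by simp) (by simp [h]) (hz i))
    have h1 : ∑ i, (m ⊔ z) i ≤ ∑ i, m i := hmax hsup
    intro i
    by_contra! hlt
    have : ∑ i, m i < ∑ i, (m ⊔ z) i :=
      Finset.sum_lt_sum (fun j _ => by simp) ⟨i, Finset.mem_univ _, by simpa using hlt⟩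
    linarith
  have heq : Pc Y Vs m = P := by
    funext i
    refine le_antisymm ?_ (hmP i)
    by_contra! hlt
    have hc : Continuous fun ε : ℝ => Pc Y Vs (m + ε • Pi.single i 1) i :=
      (continuous_apply i).comp ((cont_Pc Y Vs).comp (by fun_prop))
    have e1 : ∀ᶠ ε in nhdsWithin (0:ℝ) (Set.Ioi 0), P i < Pc Y Vs (m + ε • Pi.single i 1) i :=
      (hc.continuousAt.eventually (lt_mem_nhds (by simpa using hlt))).filter_mono
        nhdsWithin_le_nhds
    obtain ⟨ε, h1, h2⟩ := (e1.and self_mem_nhdsWithin).exists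
    have hε : 0 < ε := h2
    have hge : ∀ j, m j ≤ (m + ε • (Pi.single i 1 : Fin n → ℝ)) j := by
      intro j
      by_cases h : j = i
      · subst h; simp [hε.le]
      · simp [h]
    have := great (m + ε • Pi.single i 1) (fun j => (hm0 j).trans_le (hge j)) (fun j => by
      by_cases h : j = i
      · subst h; exact h1.le
      · exact (hmP j).trans (Pc_mono_off hZ hge (by simp [h]) (hm0 j))) i
    simp at this
    linarith
  refine ⟨m, ?_, hm0, heq⟩
  rcases alt hn hZ hI Vs hm0 with ⟨v, hv⟩ | ⟨l, hl, hA⟩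
  · apply subset_closure
    refine mem_D_neg hn hZ hI hm0 (fun i => ?_) hv
    obtain ⟨ε, hε, h1, h2⟩ := ascent hm0 hv
    have := great _ h1 (fun i => (hmP i).trans (h2 i).le) i
    simp only [Pi.add_apply, Pi.smul_apply, smul_eq_mul] at this
    by_contra! hpos
    nlinarith [mul_pos hε hpos]
  · exact mem_cl_D hn hZ hI hInn hIne hm0 hl hA

lemma D_int (hn : 1 ≤ n) {Y : Matrix (Fin n) (Fin n) ℝ} (hPD : Y.PosDef)
    (hZ : IsZmat Y) (hI : IsIrred Y)
    {Vs x : Fin n → ℝ} (hInn : ∀ i, 0 ≤ (Y *ᵥ Vs) i) (hIne : Y *ᵥ Vs ≠ 0)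
    (hx : x ∈ Dset Y Vs) : Pc Y Vs x ∈ interior (Fset Y Vs) := by
  obtain ⟨w, hw, hA⟩ := D_exists_w hn hx
  obtain ⟨ε, hε, h1, h2⟩ := ascent (Vs := Vs) hx.1 (v := -w) (fun i => by
    rw [Matrix.mulVec_neg, hA]; simp)
  rw [mem_interior_iff_mem_nhds]
  have e1 : ∀ᶠ Q in nhds (Pc Y Vs x), ∀ i, Q i < Pc Y Vs (x + ε • (-w)) i := by
    rw [Filter.eventually_all]
    exact fun i => (continuous_apply i).continuousAt.eventually (gt_mem_nhds (h2 i))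
  filter_upwards [e1] with Q hQ
  obtain ⟨m, -, hm, he⟩ := exists_sol hn hPD hZ hI hInn hIne h1 (fun i => (hQ i).le)
  exact ⟨m, hm, he⟩

lemma fr_sol (hn : 1 ≤ n) {Y : Matrix (Fin n) (Fin n) ℝ} (hPD : Y.PosDef)
    (hZ : IsZmat Y) (hI : IsIrred Y)
    {Vs P : Fin n → ℝ} (hInn : ∀ i, 0 ≤ (Y *ᵥ Vs) i) (hIne : Y *ᵥ Vs ≠ 0)
    (hP : P ∈ frontier (Fset Y Vs)) : ∃ x ∈ frontier (Dset Y Vs), Pc Y Vs x = P := by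
  obtain ⟨C, hC⟩ := bnd hPD Vs (∑ i, P i - 1)
  have cP := cont_Pc Y Vs
  let K : Set (Fin n → ℝ) := closure (Dset Y Vs) ∩ {y | ∑ i, P i - 1 ≤ ∑ i, Pc Y Vs y i}
  have hK : IsCompact K := by
    refine IsCompact.of_isClosed_subset (isCompact_Icc (a := (0 : Fin n → ℝ)) (b := fun _ => C))
      (isClosed_closure.inter (isClosed_le continuous_const
        (continuous_finsetSum _ fun i _ => (continuous_apply i).comp cP))) ?_
    rintro y ⟨h1, h2⟩
    have h0 : ∀ i, 0 ≤ y i := fun i => (cl_D_pos hn hZ hI hInn hIne h1 i).le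
    exact ⟨h0, hC y h0 h2⟩
  have hKc : IsClosed (Pc Y Vs '' K) := (hK.image cP).isClosed
  have hPK : P ∈ Pc Y Vs '' K := by
    rw [← hKc.closure_eq, mem_closure_iff_nhds]
    intro U hU
    have hV : {Q : Fin n → ℝ | ∑ i, P i - 1 < ∑ i, Q i} ∈ nhds P :=
      (isOpen_lt continuous_const (by fun_prop)).mem_nhds (by simp)
    obtain ⟨Q, ⟨hQU, hQV⟩, x, hx, hxQ⟩ :=
      mem_closure_iff_nhds.1 hP.1 _ (Filter.inter_mem hU hV)
    obtain ⟨m, hm, -, he⟩ := exists_sol hn hPD hZ hI hInn hIne hx (fun i => le_refl _)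
    rw [hxQ] at he
    refine ⟨Q, hQU, m, ⟨hm, ?_⟩, he⟩
    change ∑ i, P i - 1 ≤ ∑ i, Pc Y Vs m i
    rw [he]
    exact le_of_lt hQV
  obtain ⟨x, ⟨hx, -⟩, he⟩ := hPK
  refine ⟨x, ?_, he⟩
  rw [(D_open hn hZ hI Vs).frontier_eq]
  refine ⟨hx, fun hD => hP.2 ?_⟩
  rw [← he]
  exact D_int hn hPD hZ hI hInn hIne hD

lemma fr_map (hn : 1 ≤ n) {Y : Matrix (Fin n) (Fin n) ℝ}
    (hZ : IsZmat Y) (hI : IsIrred Y)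
    {Vs x : Fin n → ℝ} (hInn : ∀ i, 0 ≤ (Y *ᵥ Vs) i) (hIne : Y *ᵥ Vs ≠ 0)
    (hx : x ∈ frontier (Dset Y Vs)) :
    Pc Y Vs x ∈ frontier (Fset Y Vs) ∧ ∀ z, Pc Y Vs z = Pc Y Vs x → z = x := by
  obtain ⟨hp, l, hl, hA⟩ := fr_D hn hZ hI hInn hIne hx
  have hlt := fun z => max_strict (z := z) hZ hI hInn hIne hp hl hA
  refine ⟨⟨subset_closure ⟨x, hp, rfl⟩, fun hint => ?_⟩, fun z hz => ?_⟩
  · rw [mem_interior_iff_mem_nhds] at hint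
    have hc : Continuous fun ε : ℝ => Pc Y Vs x + ε • l := by fun_prop
    have e1 : ∀ᶠ ε in nhdsWithin (0:ℝ) (Set.Ioi 0), Pc Y Vs x + ε • l ∈ Fset Y Vs :=
      (hc.continuousAt.eventually (by simpa using hint)).filter_mono nhdsWithin_le_nhds
    obtain ⟨ε, ⟨z, hz, he⟩, h2⟩ := (e1.and self_mem_nhdsWithin).exists
    have hε : 0 < ε := h2
    have h1 : ∑ i, l i * Pc Y Vs z i ≤ ∑ i, l i * Pc Y Vs x i := by
      by_cases h : z = x
      · rw [h]
      · exact (hlt z h).le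
    have h3 : ∑ i, l i * Pc Y Vs x i < ∑ i, l i * Pc Y Vs z i := by
      rw [he]
      refine Finset.sum_lt_sum_of_nonempty ⟨⟨0, hn⟩, Finset.mem_univ _⟩ fun i _ => ?_
      simp only [Pi.add_apply, Pi.smul_apply, smul_eq_mul]
      have := hl i
      have : 0 < l i * (ε * l i) := by positivity
      linarith
    linarith
  · by_contra h
    have := hlt z h
    rw [hz] at this
    exact lt_irrefl _ this

end helpers

theorem stmt_18 (n : ℕ) (hn : 1 ≤ n)
    (Y : Matrix (Fin n) (Fin n) ℝ)
    (hPD : Y.PosDef)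
    (hZ : IsZmat Y)
    (hirr : IsIrred Y)
    (Vs : Fin n → ℝ) (hVs : ∀ i, 0 < Vs i)
    (hInn : ∀ i, 0 ≤ (Y *ᵥ Vs) i) (hIne : Y *ᵥ Vs ≠ 0) :
    (∀ Pt ∈ frontier (Fset Y Vs),
      (∃! x : Fin n → ℝ, Pc Y Vs x = Pt) ∧
      (∀ x : Fin n → ℝ, Pc Y Vs x = Pt → (∀ i, 0 < x i) ∧ x ∈ frontier (Dset Y Vs))) ∧
    Set.BijOn (Pc Y Vs) (frontier (Dset Y Vs)) (frontier (Fset Y Vs)) := by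
  refine ⟨fun Pt hPt => ?_, fun x hx => (fr_map hn hZ hirr hInn hIne hx).1,
    fun x hx y hy hxy => (fr_map hn hZ hirr hInn hIne hy).2 x hxy, fun P hP => ?_⟩
  · obtain ⟨x, hx, he⟩ := fr_sol hn hPD hZ hirr hInn hIne hPt
    have hu := (fr_map hn hZ hirr hInn hIne hx).2
    rw [he] at hu
    refine ⟨⟨x, he, hu⟩, fun z hz => ?_⟩
    rw [hu z hz]
    exact ⟨(fr_D hn hZ hirr hInn hIne hx).1, hx⟩
  · obtain ⟨x, hx, he⟩ := fr_sol hn hPD hZ hirr hInn hIne hP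
    exact ⟨x, hx, he⟩
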